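/- arXiv:1007.3007 — 2 statements merged into one kernel-verified Lean document; each statement's English description precedes it below -/
import Mathlib

section
/- Let B = (β_ij) be a symmetric n×n real matrix such that β_ii > 0 and ∑_{j≠i} β_ij⁻ > −β_ii for every i = 1,…,n, where β_ij⁻ = min{β_ij, 0}. Then B is strictly cubically copositive; in fact, with κ₀ := min_i (β_ii + ∑_{j≠i} β_ij⁻) > 0, one has ∑_{i,j=1}^n β_ij c_j² c_i ≥ κ₀ ∑_{i=1}^n c_i³ > 0 for every c ∈ C⁺ₙ with c ≠ 0. -/
open Finset

theorem stmt_7 (n : ℕ) (hn : 0 < n)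
    (B : Matrix (Fin n) (Fin n) ℝ) (hsym : B.IsSymm)
    (hdiag : ∀ i, 0 < B i i)
    (hdom : ∀ i, -B i i < ∑ j ∈ univ.erase i, min (B i j) 0) :
    (0 < ⨅ i, (B i i + ∑ j ∈ univ.erase i, min (B i j) 0)) ∧
    (∀ c : Fin n → ℝ, (∀ i, 0 ≤ c i) → c ≠ 0 →
      (⨅ i, (B i i + ∑ j ∈ univ.erase i, min (B i j) 0)) * ∑ i, c i ^ 3 ≤
        ∑ i, ∑ j, B i j * c j ^ 2 * c i ∧
      0 < ∑ i, ∑ j, B i j * c j ^ 2 * c i) ∧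
    (∃ μ : Fin n → ℝ, (∀ i, 0 ≤ μ i) ∧ ∀ c : Fin n → ℝ, (∀ i, 0 ≤ c i) → c ≠ 0 → 0 < ∑ i, ∑ j, B i j * c j ^ 2 * c i * μ i) := by
  haveI : Nonempty (Fin n) := ⟨⟨0, hn⟩⟩
  set r : Fin n → ℝ := fun i => B i i + ∑ j ∈ univ.erase i, min (B i j) 0 with hr
  have hpos : 0 < ⨅ i, r i := by
    obtain ⟨i, hi⟩ := exists_eq_ciInf_of_finite (f := r)
    rw [← hi]
    have := hdom i
    simp only [hr]
    linarith
  have key : ∀ c : Fin n → ℝ, (∀ i, 0 ≤ c i) → c ≠ 0 →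
      (⨅ i, r i) * ∑ i, c i ^ 3 ≤ ∑ i, ∑ j, B i j * c j ^ 2 * c i ∧
      0 < ∑ i, ∑ j, B i j * c j ^ 2 * c i := by
    intro c hc hc0
    have hcube : 0 < ∑ i, c i ^ 3 := by
      obtain ⟨i, hi⟩ := Function.ne_iff.mp hc0
      have hi' : 0 < c i := lt_of_le_of_ne (hc i) (Ne.symm hi)
      exact Finset.sum_pos' (fun j _ => pow_nonneg (hc j) 3) ⟨i, mem_univ i, pow_pos hi' 3⟩
    have h1 : (⨅ i, r i) * ∑ i, c i ^ 3 ≤ ∑ i, ∑ j, B i j * c j ^ 2 * c i := by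
      let M : Fin n → Fin n → ℝ := fun i j => if i = j then B i j else min (B i j) 0
      have hMs : ∀ i j, M i j = M j i := by
        intro i j
        simp only [M, hsym.apply i j, eq_comm]
      have hrow : ∀ i, ∑ j, M i j = r i := by
        intro i
        rw [← Finset.add_sum_erase univ _ (mem_univ i)]
        simp only [hr, M, if_true]
        congr 1
        apply Finset.sum_congr rfl
        intro j hj
        rw [if_neg (Ne.symm (Finset.ne_of_mem_erase hj))]
      have hrow3 : ∑ i, ∑ j, M i j * c i ^ 3 = ∑ i, r i * c i ^ 3 := by
        apply Finset.sum_congr rfl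
        intro i _
        rw [← Finset.sum_mul, hrow]
      have hcol3 : ∑ i, ∑ j, M i j * c j ^ 3 = ∑ i, r i * c i ^ 3 := by
        rw [Finset.sum_comm, ← hrow3]
        simp only [hMs]
      have hterm : ∀ i j, (2 / 3) * (M i j * c j ^ 3) + (1 / 3) * (M i j * c i ^ 3)
          ≤ B i j * c j ^ 2 * c i := by
        intro i j
        by_cases h : i = j
        · subst h
          simp only [M, if_true]
          apply le_of_eq
          ring
        · have e : M i j = min (B i j) 0 := if_neg h
          rw [e]
          have a1 : min (B i j) 0 ≤ B i j := min_le_left _ _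
          have a2 : min (B i j) 0 ≤ 0 := min_le_right _ _
          have p : 0 ≤ c j ^ 2 * c i := mul_nonneg (sq_nonneg _) (hc i)
          have q : 0 ≤ 2 * c j ^ 3 + c i ^ 3 - 3 * (c j ^ 2 * c i) := by
            have : 2 * c j ^ 3 + c i ^ 3 - 3 * (c j ^ 2 * c i)
              = (c j - c i) ^ 2 * (2 * c j + c i) := by ring
            rw [this]
            have := hc i
            have := hc j
            positivity
          have b1 := mul_le_mul_of_nonneg_right a1 p
          have b2 := mul_nonpos_of_nonpos_of_nonneg a2 q
          nlinarith
      calc (⨅ i, r i) * ∑ i, c i ^ 3 = ∑ i, (⨅ i, r i) * c i ^ 3 := Finset.mul_sum _ _ _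
        _ ≤ ∑ i, r i * c i ^ 3 := by
          apply Finset.sum_le_sum
          intro i _
          exact mul_le_mul_of_nonneg_right (ciInf_le (Set.finite_range r).bddBelow i)
            (pow_nonneg (hc i) 3)
        _ = ∑ i, ∑ j, ((2 / 3) * (M i j * c j ^ 3) + (1 / 3) * (M i j * c i ^ 3)) := by
          simp only [Finset.sum_add_distrib, ← Finset.mul_sum]
          simp only [Finset.mul_sum]
          simp only [← Finset.mul_sum _ _ (2 / 3 : ℝ), ← Finset.mul_sum _ _ (1 / 3 : ℝ)]
          rw [hcol3, hrow3]
          ring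
        _ ≤ _ := Finset.sum_le_sum fun i _ => Finset.sum_le_sum fun j _ => hterm i j
    exact ⟨h1, lt_of_lt_of_le (mul_pos hpos hcube) h1⟩
  refine ⟨hpos, key, fun _ => 1, fun _ => zero_le_one, fun c hc hc0 => ?_⟩
  simpa only [mul_one] using (key c hc hc0).2
end

section
/- Let p > 2 and let B = (β_ij) be a symmetric n×n real matrix such that β_ii > 0 and ∑_{j≠i} β_ij⁻ > −β_ii for every i = 1,…,n, where β_ij⁻ = min{β_ij, 0}. Then B is strictly (p−1)-copositive; in fact, with κ₀ := min_i (β_ii + ∑_{j≠i} β_ij⁻) > 0, one has ∑_{i,j=1}^n β_ij c_j^{p/2} c_i^{p/2−1} ≥ κ₀ ∑_{i=1}^n c_i^{p−1} > 0 for every c ∈ C⁺ₙ with c ≠ 0. -/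
open Finset

theorem stmt_15 (n : ℕ) (hn : 0 < n) (p : ℝ) (hp : 2 < p)
    (B : Matrix (Fin n) (Fin n) ℝ) (hsym : B.IsSymm)
    (hdiag : ∀ i, 0 < B i i)
    (hdom : ∀ i, -B i i < ∑ j ∈ univ.erase i, min (B i j) 0) :
    (0 < ⨅ i, (B i i + ∑ j ∈ univ.erase i, min (B i j) 0)) ∧
    (∀ c : Fin n → ℝ, (∀ i, 0 ≤ c i) → c ≠ 0 →
      (⨅ i, (B i i + ∑ j ∈ univ.erase i, min (B i j) 0)) * ∑ i, c i ^ (p - 1) ≤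
        ∑ i, ∑ j, B i j * c j ^ (p / 2) * c i ^ (p / 2 - 1) ∧
      0 < ∑ i, ∑ j, B i j * c j ^ (p / 2) * c i ^ (p / 2 - 1)) ∧
    (∃ μ : Fin n → ℝ, (∀ i, 0 ≤ μ i) ∧ ∀ c : Fin n → ℝ, (∀ i, 0 ≤ c i) → c ≠ 0 → 0 < ∑ i, ∑ j, B i j * c j ^ (p / 2) * c i ^ (p / 2 - 1) * μ i) := by
  haveI : Nonempty (Fin n) := ⟨⟨0, hn⟩⟩
  set r : Fin n → ℝ := fun i => B i i + ∑ j ∈ univ.erase i, min (B i j) 0 with hr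
  have hrpos : ∀ i, 0 < r i := fun i => by
    have := hdom i
    simp only [hr]
    linarith
  have hk : 0 < ⨅ i, r i := by
    obtain ⟨i, hi⟩ := exists_eq_ciInf_of_finite (f := r)
    rw [← hi]
    exact hrpos i
  have hkle : ∀ i, (⨅ i, r i) ≤ r i := fun i => ciInf_le (Set.finite_range r).bddBelow i
  have key : ∀ c : Fin n → ℝ, (∀ i, 0 ≤ c i) → c ≠ 0 →
      (⨅ i, r i) * ∑ i, c i ^ (p - 1) ≤
        ∑ i, ∑ j, B i j * c j ^ (p / 2) * c i ^ (p / 2 - 1) ∧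
      0 < ∑ i, ∑ j, B i j * c j ^ (p / 2) * c i ^ (p / 2 - 1) := by
    intro c hc hc0
    have hprod : ∀ i, c i ^ (p - 1) = c i ^ (p / 2) * c i ^ (p / 2 - 1) := fun i => by
      rw [← Real.rpow_add_of_nonneg (hc i) (by linarith) (by linarith)]
      congr 1
      ring
    have hx : ∀ i, 0 ≤ c i ^ (p / 2) := fun i => Real.rpow_nonneg (hc i) _
    have hy : ∀ i, 0 ≤ c i ^ (p / 2 - 1) := fun i => Real.rpow_nonneg (hc i) _
    have hre : ∀ i j, 0 ≤ (c i ^ (p / 2) - c j ^ (p / 2)) *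
        (c i ^ (p / 2 - 1) - c j ^ (p / 2 - 1)) := by
      intro i j
      rcases le_total (c i) (c j) with h | h
      · exact mul_nonneg_of_nonpos_of_nonpos
          (sub_nonpos.2 (Real.rpow_le_rpow (hc i) h (by linarith)))
          (sub_nonpos.2 (Real.rpow_le_rpow (hc i) h (by linarith)))
      · exact mul_nonneg
          (sub_nonneg.2 (Real.rpow_le_rpow (hc j) h (by linarith)))
          (sub_nonneg.2 (Real.rpow_le_rpow (hc j) h (by linarith)))
    have hpos : 0 < ∑ i, c i ^ (p - 1) := by
      obtain ⟨i, hi⟩ := Function.ne_iff.1 hc0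
      exact Finset.sum_pos' (fun i _ => Real.rpow_nonneg (hc i) _)
        ⟨i, mem_univ i, Real.rpow_pos_of_pos (lt_of_le_of_ne (hc i) (Ne.symm hi)) _⟩
    simp only [hprod] at hpos ⊢
    generalize hX : (fun i => c i ^ (p / 2)) = x
    generalize hY : (fun i => c i ^ (p / 2 - 1)) = y
    have hX' : ∀ i, c i ^ (p / 2) = x i := fun i => congrFun hX i
    have hY' : ∀ i, c i ^ (p / 2 - 1) = y i := fun i => congrFun hY i
    simp only [hX', hY'] at hx hy hre hpos ⊢
    set M : Fin n → Fin n → ℝ := fun i j => if j = i then B i i else min (B i j) 0 with hM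
    have hrow : ∀ i, ∑ j, M i j = r i := by
      intro i
      rw [← Finset.add_sum_erase univ _ (mem_univ i)]
      simp only [hM, hr, if_true]
      congr 1
      exact Finset.sum_congr rfl fun j hj => by rw [if_neg (Finset.ne_of_mem_erase hj)]
    have hMs : ∀ i j, M i j = M j i := by
      intro i j
      by_cases h : j = i
      · rw [h]
      · simp only [hM, if_neg h, if_neg (Ne.symm h), hsym.apply i j]
    have hpair : ∀ i j, M i j * (x i * y i) + M i j * (x j * y j) ≤
        B i j * x j * y i + B j i * x i * y j := by
      intro i j
      by_cases h : j = i
      · subst h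
        simp only [hM, if_true]
        linarith
      · simp only [hM, if_neg h, hsym.apply i j]
        have h1 : min (B i j) 0 ≤ B i j := min_le_left _ _
        have h2 : min (B i j) 0 ≤ 0 := min_le_right _ _
        have h3 := mul_nonneg (hx j) (hy i)
        have h4 := mul_nonneg (hx i) (hy j)
        have h5 := mul_nonneg (sub_nonneg.2 h1) (add_nonneg h3 h4)
        have h6 := mul_nonneg (neg_nonneg.2 h2) (hre i j)
        nlinarith
    have hsum := Finset.sum_le_sum fun i (_ : i ∈ univ) =>
      Finset.sum_le_sum fun j (_ : j ∈ univ) => hpair i j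
    simp only [Finset.sum_add_distrib] at hsum
    have e1 : ∑ i, ∑ j, M i j * (x i * y i) = ∑ i, r i * (x i * y i) := by
      simp only [← Finset.sum_mul, hrow]
    have e2 : ∑ i, ∑ j, M i j * (x j * y j) = ∑ i, r i * (x i * y i) := by
      rw [Finset.sum_comm, ← e1]
      exact Finset.sum_congr rfl fun i _ => Finset.sum_congr rfl fun j _ => by rw [hMs j i]
    have e3 : ∑ i, ∑ j, B j i * x i * y j = ∑ i, ∑ j, B i j * x j * y i := Finset.sum_comm
    have e4 : (⨅ i, r i) * ∑ i, x i * y i ≤ ∑ i, r i * (x i * y i) := by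
      rw [Finset.mul_sum]
      exact Finset.sum_le_sum fun i _ =>
        mul_le_mul_of_nonneg_right (hkle i) (mul_nonneg (hx i) (hy i))
    have main : (⨅ i, r i) * ∑ i, x i * y i ≤ ∑ i, ∑ j, B i j * x j * y i := by linarith
    exact ⟨main, lt_of_lt_of_le (mul_pos hk hpos) main⟩
  refine ⟨hk, key, fun _ => 1, fun _ => zero_le_one, fun c hc h0 => ?_⟩
  simpa only [mul_one] using (key c hc h0).2
end
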